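/- For the Sierpinski gasket S with natural measure μ and s = log 3/log 2: for every d with 0 < d ≤ 1/2, B(z₀, d) ∩ S = B(z₀, d) ∩ f₀(S) and θ_μ^s(z₀, d) = θ_μ^s(z₀, 2d). Consequently, θ̲_μ^s(z₀) = min{θ_μ^s(z₀, d) : 1/2 ≤ d ≤ 1} and θ̄_μ^s(z₀) = max{θ_μ^s(z₀, d) : 1/2 ≤ d ≤ 1}, these extrema being attained. -/

import Mathlib

open MeasureTheory Filter Topology
open scoped ENNReal

noncomputable section

/-- The point `(a, b)` of the Euclidean plane. -/
def pt (a b : ℝ) : EuclideanSpace ℝ (Fin 2) :=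
  (WithLp.equiv 2 (Fin 2 → ℝ)).symm ![a, b]

/-- The three contracting similarities generating the Sierpinski gasket. -/
def sierf : Fin 3 → EuclideanSpace ℝ (Fin 2) → EuclideanSpace ℝ (Fin 2) :=
  ![fun v => (1/2 : ℝ) • v,
    fun v => (1/2 : ℝ) • v + pt (1/2) 0,
    fun v => (1/2 : ℝ) • v + pt (1/4) (Real.sqrt 3 / 4)]

/-- The vertices `z₀, z₁, z₂` of the Sierpinski gasket. -/
def vert : Fin 3 → EuclideanSpace ℝ (Fin 2) :=
  ![pt 0 0, pt 1 0, pt (1/2) (Real.sqrt 3 / 2)]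

/-- The similarity dimension `s = log 3 / log 2` of the Sierpinski gasket. -/
def sierDim : ℝ := Real.log 3 / Real.log 2

/-- The `s`-density `θ_μ^s(x, d) = μ(B(x,d)) / (2d)^s` of the closed ball `B(x, d)`. -/
def sdens (μ : Measure (EuclideanSpace ℝ (Fin 2))) (s : ℝ)
    (x : EuclideanSpace ℝ (Fin 2)) (d : ℝ) : ℝ≥0∞ :=
  μ (Metric.closedBall x d) / ENNReal.ofReal ((2 * d) ^ s)

lemma vert_zero : vert 0 = 0 := by
  ext i; fin_cases i <;> simp [vert, pt]

lemma plane_ext {v w : EuclideanSpace ℝ (Fin 2)} (h0 : v 0 = w 0) (h1 : v 1 = w 1) : v = w := by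
  ext i; fin_cases i
  · exact h0
  · exact h1

lemma sierf_eq_smul_add (i : Fin 3) (v : EuclideanSpace ℝ (Fin 2)) :
    sierf i v = (1 / 2 : ℝ) • v + (1 / 2 : ℝ) • vert i := by
  apply plane_ext <;> fin_cases i <;> simp [sierf, vert, pt] <;> ring

lemma sierf_vert (i : Fin 3) : sierf i (vert i) = vert i := by
  rw [sierf_eq_smul_add, ← add_smul]; norm_num

lemma sierf_vert_comm (i j : Fin 3) : sierf i (vert j) = sierf j (vert i) := by
  rw [sierf_eq_smul_add, sierf_eq_smul_add, add_comm]

lemma dist_sierf (i : Fin 3) (v w : EuclideanSpace ℝ (Fin 2)) :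
    dist (sierf i v) (sierf i w) = dist v w / 2 := by
  rw [sierf_eq_smul_add, sierf_eq_smul_add, dist_add_right, dist_smul₀]
  norm_num; ring

lemma continuous_sierf (i : Fin 3) : Continuous (sierf i) := by
  rw [funext (sierf_eq_smul_add i)]; fun_prop

lemma vert_nonneg (i : Fin 3) (j : Fin 2) : 0 ≤ vert i j := by
  fin_cases i <;> fin_cases j <;> simp [vert, pt]; positivity

lemma norm_vert {i : Fin 3} (hi : i ≠ 0) : ‖vert i‖ = 1 := by
  have h3 : (√3) ^ 2 = 3 := Real.sq_sqrt (by norm_num)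
  have : ‖vert i‖ ^ 2 = 1 := by
    rw [EuclideanSpace.real_norm_sq_eq, Fin.sum_univ_two]
    fin_cases i
    · exact absurd rfl hi
    · simp [vert, pt]
    · simp [vert, pt, div_pow]; norm_num
  exact (pow_eq_one_iff_of_nonneg (norm_nonneg _) two_ne_zero).1 this

/-- A point of the closed first quadrant that a map `sierf i`, `i ≠ 0`, sends into the ball of
radius `1 / 2` about the origin is the origin. -/
lemma eq_zero_of_norm_sierf_le {i : Fin 3} (hi : i ≠ 0) {w : EuclideanSpace ℝ (Fin 2)}
    (hw : ∀ j, 0 ≤ w j) (h : ‖sierf i w‖ ≤ 1 / 2) : w = 0 := by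
  have hinner : 0 ≤ inner ℝ w (vert i) := by
    rw [PiLp.inner_apply]
    exact Finset.sum_nonneg fun j _ => by
      simpa using mul_nonneg (vert_nonneg i j) (hw j)
  rw [sierf_eq_smul_add, ← smul_add, norm_smul] at h
  have h1 : ‖w + vert i‖ ≤ 1 := by
    norm_num at h; linarith
  have h2 := norm_add_sq_real w (vert i)
  rw [norm_vert hi] at h2
  have h3 : ‖w‖ ^ 2 ≤ 0 := by nlinarith [norm_nonneg (w + vert i)]
  exact norm_eq_zero.1 (pow_eq_zero_iff two_ne_zero |>.1 (le_antisymm h3 (by positivity)))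

section Attractor

variable {S : Set (EuclideanSpace ℝ (Fin 2))}

lemma vert_mem_attractor (hSc : IsCompact S) (hSne : S.Nonempty)
    (hSattr : S = ⋃ i, sierf i '' S) (i : Fin 3) : vert i ∈ S := by
  obtain ⟨w, hw, hmin⟩ := hSc.exists_isMinOn hSne
    (f := fun v => dist v (vert i)) (by fun_prop)
  have hmem : sierf i w ∈ S := by
    rw [hSattr]; exact Set.mem_iUnion.2 ⟨i, w, hw, rfl⟩
  have h : dist w (vert i) ≤ dist (sierf i w) (vert i) := hmin hmem
  rw [← sierf_vert i, dist_sierf, sierf_vert] at h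
  have h0 : dist w (vert i) = 0 := le_antisymm (by linarith) dist_nonneg
  rwa [← dist_eq_zero.1 h0]

lemma attractor_nonneg (hSc : IsCompact S) (hSattr : S = ⋃ i, sierf i '' S)
    {v : EuclideanSpace ℝ (Fin 2)} (hv : v ∈ S) (j : Fin 2) : 0 ≤ v j := by
  obtain ⟨w, hw, hmin⟩ := hSc.exists_isMinOn ⟨v, hv⟩ (f := fun v => v j) (by fun_prop)
  have hvw : w j ≤ v j := hmin hv
  rw [hSattr] at hw
  obtain ⟨i, u, hu, rfl⟩ := Set.mem_iUnion.1 hw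
  have huw : sierf i u j ≤ u j := hmin hu
  have hij : sierf i u j = u j / 2 + vert i j / 2 := by
    rw [sierf_eq_smul_add]; simp; ring
  linarith [vert_nonneg i j]

lemma closedBall_inter_attractor (hSc : IsCompact S) (hSne : S.Nonempty)
    (hSattr : S = ⋃ i, sierf i '' S) {d : ℝ} (hd : d ≤ 1 / 2) :
    Metric.closedBall (vert 0) d ∩ S = Metric.closedBall (vert 0) d ∩ (sierf 0 '' S) := by
  apply Set.Subset.antisymm
  · rintro v ⟨hvd, hv⟩
    refine ⟨hvd, ?_⟩
    rw [hSattr] at hv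
    obtain ⟨i, u, hu, rfl⟩ := Set.mem_iUnion.1 hv
    by_cases hi : i = 0
    · subst hi; exact ⟨u, hu, rfl⟩
    · rw [vert_zero, mem_closedBall_zero_iff] at hvd
      rw [eq_zero_of_norm_sierf_le hi (attractor_nonneg hSc hSattr hu) (hvd.trans hd),
        ← vert_zero, sierf_vert_comm]
      exact ⟨_, vert_mem_attractor hSc hSne hSattr i, rfl⟩
  · refine Set.inter_subset_inter_right _ fun v hv => ?_
    rw [hSattr]; exact Set.mem_iUnion.2 ⟨0, hv⟩

end Attractor

section InvariantMeasure

variable {μ : Measure (EuclideanSpace ℝ (Fin 2))}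

lemma lintegral_of_invariant
    (hinv : μ = (3 : ℝ≥0∞)⁻¹ • (μ.map (sierf 0) + μ.map (sierf 1) + μ.map (sierf 2)))
    {g : EuclideanSpace ℝ (Fin 2) → ℝ≥0∞} (hg : Measurable g) :
    ∫⁻ p, g p ∂μ = 3⁻¹ * (∫⁻ p, (g (sierf 0 p) + g (sierf 1 p)) ∂μ + ∫⁻ p, g (sierf 2 p) ∂μ) := by
  have hm (i : Fin 3) := (continuous_sierf i).measurable
  conv_lhs => rw [hinv]
  rw [lintegral_smul_measure, lintegral_add_measure, lintegral_add_measure,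
    lintegral_map hg (hm 0), lintegral_map hg (hm 1), lintegral_map hg (hm 2),
    lintegral_add_left (f := fun p => g (sierf 0 p)) (hg.comp (hm 0)), smul_eq_mul]

/-- If the sums of `g` over `2 ^ n` horizontal translates, with step `2 ^ (-n)`, are at most `1`,
then the integral of `g` is at most `(2 / 3) ^ n`. -/
lemma lintegral_le_of_sum_translates_le [IsProbabilityMeasure μ]
    (hinv : μ = (3 : ℝ≥0∞)⁻¹ • (μ.map (sierf 0) + μ.map (sierf 1) + μ.map (sierf 2)))
    (n : ℕ) {g : EuclideanSpace ℝ (Fin 2) → ℝ≥0∞} (hg : Measurable g)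
    (hsum : ∀ p, ∑ k ∈ Finset.range (2 ^ n), g (p + pt (k / 2 ^ n) 0) ≤ 1) :
    ∫⁻ p, g p ∂μ ≤ (3⁻¹ * 2) ^ n := by
  induction n generalizing g with
  | zero =>
    have h0 : pt 0 0 = 0 := vert_zero
    have h : ∀ p, g p ≤ 1 := fun p => by simpa [h0] using hsum p
    calc ∫⁻ p, g p ∂μ ≤ ∫⁻ _, 1 ∂μ := lintegral_mono h
      _ = (3⁻¹ * 2) ^ 0 := by simp
  | succ n ih =>
    have hm (i : Fin 3) := hg.comp (continuous_sierf i).measurable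
    have hp : (0 : ℝ) < 2 ^ n := by positivity
    have hshift (i : Fin 3) (p : EuclideanSpace ℝ (Fin 2)) (k : ℕ) :
        sierf i (p + pt (k / 2 ^ n) 0) = sierf i p + pt (k / 2 ^ (n + 1)) 0 := by
      rw [sierf_eq_smul_add, sierf_eq_smul_add]
      apply plane_ext <;> simp [pt]
      field_simp
      ring
    have hshift_one (p : EuclideanSpace ℝ (Fin 2)) (k : ℕ) :
        sierf 1 (p + pt (k / 2 ^ n) 0) =
          sierf 0 p + pt ((2 ^ n + k : ℕ) / 2 ^ (n + 1)) 0 := by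
      rw [sierf_eq_smul_add, sierf_eq_smul_add]
      apply plane_ext <;> simp [pt, vert]
      field_simp
      ring
    have hpow : 2 ^ (n + 1) = 2 ^ n + 2 ^ n := by ring
    have h01 : ∫⁻ p, (g (sierf 0 p) + g (sierf 1 p)) ∂μ ≤ (3⁻¹ * 2) ^ n := by
      refine ih ((hm 0).add (hm 1)) fun p => ?_
      rw [Finset.sum_add_distrib]
      refine le_of_eq_of_le ?_ (hsum (sierf 0 p))
      rw [hpow, Finset.sum_range_add]
      simp only [hshift 0, hshift_one]
    have h2 : ∫⁻ p, g (sierf 2 p) ∂μ ≤ (3⁻¹ * 2) ^ n := by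
      refine ih (hm 2) fun p => ?_
      refine le_trans ?_ (hsum (sierf 2 p))
      simp only [hshift 2]
      exact Finset.sum_le_sum_of_subset (Finset.range_mono (by rw [hpow]; exact Nat.le_add_right _ _))
    rw [lintegral_of_invariant hinv hg]
    calc _ ≤ (3⁻¹ : ℝ≥0∞) * ((3⁻¹ * 2) ^ n + (3⁻¹ * 2) ^ n) := by gcongr
      _ = (3⁻¹ * 2) ^ (n + 1) := by ring

/-- A measurable set meeting each horizontal line in at most one point is null. -/
lemma measure_eq_zero_of_injOn [IsProbabilityMeasure μ]
    (hinv : μ = (3 : ℝ≥0∞)⁻¹ • (μ.map (sierf 0) + μ.map (sierf 1) + μ.map (sierf 2)))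
    {A : Set (EuclideanSpace ℝ (Fin 2))} (hA : MeasurableSet A)
    (hinj : Set.InjOn (fun v : EuclideanSpace ℝ (Fin 2) => v 1) A) : μ A = 0 := by
  have hle (n : ℕ) : μ A ≤ (3⁻¹ * 2) ^ n := by
    rw [← lintegral_indicator_one hA]
    refine lintegral_le_of_sum_translates_le hinv n (measurable_one.indicator hA) fun p => ?_
    by_cases hex : ∃ k ∈ Finset.range (2 ^ n), p + pt (k / 2 ^ n) 0 ∈ A
    · obtain ⟨k, hk, hkA⟩ := hex
      rw [Finset.sum_eq_single_of_mem k hk]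
      · exact Set.indicator_le_self' (by simp) _ |>.trans (by simp)
      · intro l _ hlk
        refine Set.indicator_of_notMem (fun hlA => hlk ?_) _
        have h := hinj hlA hkA (by simp [pt])
        simpa [pt] using congrArg (fun v : EuclideanSpace ℝ (Fin 2) => v 0) h
    · push Not at hex
      rw [Finset.sum_eq_zero fun k hk => Set.indicator_of_notMem (hex k hk) _]
      exact zero_le
  have hlt : (3⁻¹ * 2 : ℝ≥0∞) < 1 := by
    rw [mul_comm, ← div_eq_mul_inv]
    exact ENNReal.div_lt_of_lt_mul (by norm_num)
  exact le_antisymm (ge_of_tendsto' (ENNReal.tendsto_pow_atTop_nhds_zero_of_lt_one hlt) hle)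
    (zero_le)

variable {S : Set (EuclideanSpace ℝ (Fin 2))}

lemma measure_sphere_eq_zero [IsProbabilityMeasure μ] (hSc : IsCompact S)
    (hSattr : S = ⋃ i, sierf i '' S) (hsupp : μ Sᶜ = 0)
    (hinv : μ = (3 : ℝ≥0∞)⁻¹ • (μ.map (sierf 0) + μ.map (sierf 1) + μ.map (sierf 2)))
    (r : ℝ) : μ (Metric.sphere 0 r) = 0 := by
  have hA : μ (Metric.sphere 0 r ∩ S) = 0 := by
    refine measure_eq_zero_of_injOn hinv
      (Metric.isClosed_sphere.measurableSet.inter hSc.measurableSet) ?_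
    rintro v ⟨hv, hvS⟩ w ⟨hw, hwS⟩ h
    refine plane_ext ?_ h
    have h1 : v 1 = w 1 := h
    have hv2 := EuclideanSpace.real_norm_sq_eq v
    have hw2 := EuclideanSpace.real_norm_sq_eq w
    rw [mem_sphere_zero_iff_norm.1 hv, Fin.sum_univ_two, h1] at hv2
    rw [mem_sphere_zero_iff_norm.1 hw, Fin.sum_univ_two] at hw2
    exact (pow_left_inj₀ (attractor_nonneg hSc hSattr hvS 0)
      (attractor_nonneg hSc hSattr hwS 0) two_ne_zero).1 (by linarith)
  exact measure_mono_null (fun v hv => (em (v ∈ S)).imp (fun h => ⟨hv, h⟩) id)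
    (measure_union_null hA hsupp)

lemma measure_closedBall_eq [IsProbabilityMeasure μ] (hSc : IsCompact S)
    (hSattr : S = ⋃ i, sierf i '' S) (hsupp : μ Sᶜ = 0)
    (hinv : μ = (3 : ℝ≥0∞)⁻¹ • (μ.map (sierf 0) + μ.map (sierf 1) + μ.map (sierf 2)))
    {d : ℝ} (hd : d ≤ 1 / 2) :
    μ (Metric.closedBall 0 d) = 3⁻¹ * μ (Metric.closedBall 0 (2 * d)) := by
  have hm (i : Fin 3) := (continuous_sierf i).measurable
  have hB : MeasurableSet (Metric.closedBall (0 : EuclideanSpace ℝ (Fin 2)) d) :=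
    Metric.isClosed_closedBall.measurableSet
  have hzero : μ {0} = 0 := by
    simpa using measure_sphere_eq_zero hSc hSattr hsupp hinv 0
  have hi (i : Fin 3) (hi : i ≠ 0) : μ (sierf i ⁻¹' Metric.closedBall 0 d) = 0 := by
    refine measure_mono_null (t := {0} ∪ Sᶜ) (fun v hv => ?_) (measure_union_null hzero hsupp)
    by_cases hvS : v ∈ S
    · exact Or.inl (eq_zero_of_norm_sierf_le hi (attractor_nonneg hSc hSattr hvS)
        ((mem_closedBall_zero_iff.1 hv).trans hd))
    · exact Or.inr hvS
  have h0 : sierf 0 ⁻¹' Metric.closedBall 0 d = Metric.closedBall 0 (2 * d) := by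
    ext v
    have h : sierf 0 0 = 0 := by rw [← vert_zero, sierf_vert]
    rw [Set.mem_preimage, Metric.mem_closedBall, Metric.mem_closedBall]
    conv_lhs => rw [← h, dist_sierf]
    constructor <;> intro <;> linarith
  conv_lhs => rw [hinv]
  rw [Measure.smul_apply, Measure.add_apply, Measure.add_apply, Measure.map_apply (hm 0) hB,
    Measure.map_apply (hm 1) hB, Measure.map_apply (hm 2) hB, hi 1 (by decide),
    hi 2 (by decide), h0, add_zero, add_zero, smul_eq_mul]

lemma two_rpow_sierDim : (2 : ℝ) ^ sierDim = 3 := by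
  have h : Real.log 2 ≠ 0 := (Real.log_pos (by norm_num)).ne'
  rw [Real.rpow_def_of_pos (by norm_num), sierDim, mul_div_cancel₀ _ h,
    Real.exp_log (by norm_num)]

lemma sdens_two_mul [IsProbabilityMeasure μ] (hSc : IsCompact S)
    (hSattr : S = ⋃ i, sierf i '' S) (hsupp : μ Sᶜ = 0)
    (hinv : μ = (3 : ℝ≥0∞)⁻¹ • (μ.map (sierf 0) + μ.map (sierf 1) + μ.map (sierf 2)))
    {d : ℝ} (hd0 : 0 < d) (hd : d ≤ 1 / 2) :
    sdens μ sierDim (vert 0) d = sdens μ sierDim (vert 0) (2 * d) := by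
  have hpow : ENNReal.ofReal ((2 * (2 * d)) ^ sierDim) =
      3 * ENNReal.ofReal ((2 * d) ^ sierDim) := by
    rw [Real.mul_rpow (by norm_num) (by positivity), two_rpow_sierDim,
      ENNReal.ofReal_mul (by norm_num)]
    norm_num
  rw [sdens, sdens, hpow, vert_zero, measure_closedBall_eq hSc hSattr hsupp hinv hd,
    ENNReal.div_eq_inv_mul, ENNReal.div_eq_inv_mul,
    ENNReal.mul_inv (Or.inl (by norm_num)) (Or.inl (by norm_num))]
  ring

lemma continuousAt_sdens [IsProbabilityMeasure μ] (hsphere : ∀ r, μ (Metric.sphere 0 r) = 0)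
    {d : ℝ} (hd : 0 < d) (s : ℝ) : ContinuousAt (sdens μ s (vert 0)) d := by
  refine ENNReal.Tendsto.div ?_ (Or.inr ?_) ?_ (Or.inl ENNReal.ofReal_ne_top)
  · rw [vert_zero]
    refine tendsto_measure_of_ae_tendsto_indicator_of_isFiniteMeasure (𝓝 d)
      Metric.isClosed_closedBall.measurableSet
      (fun _ => Metric.isClosed_closedBall.measurableSet) ?_
    filter_upwards [measure_eq_zero_iff_ae_notMem.1 (hsphere d)] with x hx
    simp only [mem_closedBall_zero_iff]
    rcases lt_or_gt_of_ne (mt mem_sphere_zero_iff_norm.2 hx) with h | h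
    · filter_upwards [lt_mem_nhds h] with e he
      exact ⟨fun _ => h.le, fun _ => he.le⟩
    · filter_upwards [gt_mem_nhds h] with e he
      exact ⟨fun h' => absurd he h'.not_gt, fun h' => absurd h h'.not_gt⟩
  · simpa using Real.rpow_pos_of_pos (by positivity) s
  · refine ENNReal.tendsto_ofReal ?_
    exact ((continuous_const.mul continuous_id).tendsto d).rpow_const
      (Or.inl (mul_pos two_pos hd).ne')

end InvariantMeasure

section DoublingInvariance

variable {α : Type*} {f : ℝ → α}

lemma exists_Icc_eq_of_two_mul (hf : ∀ d, 0 < d → d ≤ 1 / 2 → f d = f (2 * d))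
    {d : ℝ} (hd : 0 < d) (hd1 : d ≤ 1) : ∃ e ∈ Set.Icc (1 / 2 : ℝ) 1, f d = f e := by
  obtain ⟨n, hn⟩ := pow_unbounded_of_one_lt d⁻¹ (one_lt_two (α := ℝ))
  have h : 1 / 2 ≤ 2 ^ n * d := by
    have := (inv_lt_iff_one_lt_mul₀ hd).1 hn
    linarith
  clear hn
  induction n generalizing d with
  | zero => exact ⟨d, ⟨by simpa using h, hd1⟩, rfl⟩
  | succ n ih =>
    by_cases hd2 : d ≤ 1 / 2
    · rw [hf d hd hd2]
      exact ih (by positivity) (by linarith) (by rw [pow_succ] at h; linarith)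
    · exact ⟨d, ⟨(not_le.1 hd2).le, hd1⟩, rfl⟩

lemma frequently_eq_of_two_mul (hf : ∀ d, 0 < d → d ≤ 1 / 2 → f d = f (2 * d))
    {d : ℝ} (hd : 0 < d) (hd1 : d ≤ 1) : ∃ᶠ e in 𝓝[>] (0 : ℝ), f e = f d := by
  have heq (n : ℕ) : f (d * (1 / 2) ^ n) = f d := by
    induction n with
    | zero => simp
    | succ n ih =>
      have hle : (1 / 2 : ℝ) ^ n ≤ 1 := pow_le_one₀ (by norm_num) (by norm_num)
      have hpos : (0 : ℝ) < (1 / 2) ^ n := by positivity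
      rw [hf _ (by positivity) (by rw [pow_succ]; nlinarith), ← ih]
      congr 1
      ring
  have hlim : Tendsto (fun n : ℕ => d * (1 / 2 : ℝ) ^ n) atTop (𝓝[>] 0) := by
    refine tendsto_nhdsWithin_iff.2 ⟨?_, Eventually.of_forall fun n => ?_⟩
    · simpa using (tendsto_pow_atTop_nhds_zero_of_lt_one (r := (1 / 2 : ℝ))
        (by norm_num) (by norm_num)).const_mul d
    · exact Set.mem_Ioi.2 (by positivity)
  exact hlim.frequently (Frequently.of_forall heq)

variable [CompleteLinearOrder α] [TopologicalSpace α] [OrderTopology α]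

lemma isLeast_liminf_of_two_mul (hf : ∀ d, 0 < d → d ≤ 1 / 2 → f d = f (2 * d))
    (hc : ContinuousOn f (Set.Icc (1 / 2) 1)) :
    IsLeast {t | ∃ d ∈ Set.Icc (1 / 2 : ℝ) 1, t = f d} (liminf f (𝓝[>] 0)) := by
  obtain ⟨d, hd, hmin⟩ := isCompact_Icc.exists_isMinOn (Set.nonempty_Icc.2 (by norm_num)) hc
  have heq : liminf f (𝓝[>] 0) = f d := by
    apply le_antisymm
    · exact liminf_le_of_frequently_le'
        ((frequently_eq_of_two_mul hf (by linarith [hd.1]) hd.2).mono fun _ h => h.le)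
    · refine le_liminf_of_le (by isBoundedDefault) ?_
      filter_upwards [Ioc_mem_nhdsGT (zero_lt_one' ℝ)] with e he
      obtain ⟨e', he', h⟩ := exists_Icc_eq_of_two_mul hf he.1 he.2
      exact h ▸ hmin he'
  rw [heq]
  exact ⟨⟨d, hd, rfl⟩, by rintro _ ⟨e, he, rfl⟩; exact hmin he⟩

lemma isGreatest_limsup_of_two_mul (hf : ∀ d, 0 < d → d ≤ 1 / 2 → f d = f (2 * d))
    (hc : ContinuousOn f (Set.Icc (1 / 2) 1)) :
    IsGreatest {t | ∃ d ∈ Set.Icc (1 / 2 : ℝ) 1, t = f d} (limsup f (𝓝[>] 0)) :=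
  isLeast_liminf_of_two_mul (α := αᵒᵈ) hf hc

end DoublingInvariance

/-- for the Sierpinski gasket `S` with natural measure `μ` and
`s = log 3 / log 2`: for `0 < d ≤ 1/2`, `B(z₀,d) ∩ S = B(z₀,d) ∩ f₀(S)` and
`θ_μ^s(z₀, d) = θ_μ^s(z₀, 2d)`; consequently the lower (resp. upper) density at `z₀`
is the attained minimum (resp. maximum) of `θ_μ^s(z₀, ·)` on `[1/2, 1]`. -/
theorem stmt16
    (S : Set (EuclideanSpace ℝ (Fin 2))) (hSc : IsCompact S) (hSne : S.Nonempty)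
    (hSattr : S = ⋃ i, sierf i '' S)
    (μ : Measure (EuclideanSpace ℝ (Fin 2))) (hprob : IsProbabilityMeasure μ)
    (hsupp : μ Sᶜ = 0)
    (hinv : μ = (3 : ℝ≥0∞)⁻¹ • (μ.map (sierf 0) + μ.map (sierf 1) + μ.map (sierf 2))) :
    (∀ d : ℝ, 0 < d → d ≤ 1/2 →
      Metric.closedBall (vert 0) d ∩ S = Metric.closedBall (vert 0) d ∩ (sierf 0 '' S) ∧
      sdens μ sierDim (vert 0) d = sdens μ sierDim (vert 0) (2 * d)) ∧
    IsLeast {t : ℝ≥0∞ | ∃ d ∈ Set.Icc (1/2 : ℝ) 1, t = sdens μ sierDim (vert 0) d}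
      (Filter.liminf (fun d => sdens μ sierDim (vert 0) d) (nhdsWithin 0 (Set.Ioi 0))) ∧
    IsGreatest {t : ℝ≥0∞ | ∃ d ∈ Set.Icc (1/2 : ℝ) 1, t = sdens μ sierDim (vert 0) d}
      (Filter.limsup (fun d => sdens μ sierDim (vert 0) d) (nhdsWithin 0 (Set.Ioi 0))) := by
  have hdens : ∀ d : ℝ, 0 < d → d ≤ 1 / 2 →
      sdens μ sierDim (vert 0) d = sdens μ sierDim (vert 0) (2 * d) :=
    fun d => sdens_two_mul hSc hSattr hsupp hinv
  have hcont : ContinuousOn (sdens μ sierDim (vert 0)) (Set.Icc (1 / 2) 1) := fun d hd =>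
    (continuousAt_sdens (measure_sphere_eq_zero hSc hSattr hsupp hinv)
      (by linarith [hd.1]) sierDim).continuousWithinAt
  exact ⟨fun d hd0 hd => ⟨closedBall_inter_attractor hSc hSne hSattr hd, hdens d hd0 hd⟩,
    isLeast_liminf_of_two_mul hdens hcont, isGreatest_limsup_of_two_mul hdens hcont⟩
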